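/- For α ∈ (0,1) and x ≥ 0, the Mittag-Leffler function E_α satisfies 1/(1 + Γ(1−α)·x) ≤ E_α(−x) ≤ 1/(1 + x/Γ(1+α)). -/

import Mathlib

open MeasureTheory Set Filter Topology

noncomputable def mlE (α β z : ℝ) : ℝ := ∑' j : ℕ, z ^ j / Real.Gamma (α * j + β)

lemma ml_gamma_lower {c y : ℝ} (hc : 0 < c) (hy : 1 ≤ y) :
    Real.exp (-c) * c ^ (y - 1) ≤ Real.Gamma y := by
  have hy0 : 0 < y := by linarith
  rw [Real.Gamma_eq_integral hy0]
  have hint := Real.GammaIntegral_convergent hy0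
  have hsub : Ioi c ⊆ Ioi (0:ℝ) := Ioi_subset_Ioi hc.le
  have h1 : ∫ x in Ioi c, Real.exp (-x) * c ^ (y-1) ≤ ∫ x in Ioi c, Real.exp (-x) * x ^ (y-1) := by
    apply setIntegral_mono_on
    · exact (integrableOn_exp_neg_Ioi c).mul_const _
    · exact hint.mono_set hsub
    · exact measurableSet_Ioi
    · intro x hx
      have hx' : c < x := hx
      gcongr
  have h2 : ∫ x in Ioi c, Real.exp (-x) * x ^ (y-1) ≤ ∫ x in Ioi 0, Real.exp (-x) * x ^ (y-1) := by
    apply setIntegral_mono_set hint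
    · filter_upwards [ae_restrict_mem measurableSet_Ioi] with x hx
      have hx' : (0:ℝ) < x := hx
      simp only [Pi.zero_apply]; positivity
    · exact hsub.eventuallyLE
  rw [integral_mul_const, integral_exp_neg_Ioi] at h1
  linarith

lemma ml_summable {α β : ℝ} (hα : 0 < α) (hβ : 0 < β) {x : ℝ} (hx : 0 ≤ x) :
    Summable (fun j : ℕ => x ^ j / Real.Gamma (α * j + β)) := by
  set c : ℝ := (2 * (x+1)) ^ (1/α) with hcdef
  have hc : 0 < c := by positivity
  have hca : c ^ α = 2 * (x+1) := by
    rw [hcdef, ← Real.rpow_mul (by positivity)]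
    field_simp
    simp
  have hg : Summable (fun j : ℕ => (Real.exp c * c ^ (1-β)) * (1/2:ℝ)^j) :=
    (summable_geometric_two).mul_left _
  apply Summable.of_norm_bounded_eventually_nat hg
  have hev : ∀ᶠ j : ℕ in atTop, (1 ≤ α * (j:ℝ)) := by
    have : Tendsto (fun j : ℕ => α * (j:ℝ)) atTop atTop :=
      tendsto_natCast_atTop_atTop.const_mul_atTop hα
    exact this.eventually_ge_atTop 1
  filter_upwards [hev] with j hj
  have hG := ml_gamma_lower (c := c) (y := α * j + β) hc (by linarith)
  have hGp : 0 < Real.Gamma (α * j + β) := Real.Gamma_pos_of_pos (by linarith)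
  rw [Real.norm_of_nonneg (by positivity), div_le_iff₀ hGp]
  have e1 : c ^ (α * j + β - 1) = (2*(x+1))^j * c ^ (β - 1) := by
    rw [show α * j + β - 1 = α * j + (β - 1) by ring, Real.rpow_add hc, Real.rpow_mul hc.le, hca,
      Real.rpow_natCast]
  rw [e1] at hG
  have e2 : Real.exp c * Real.exp (-c) = 1 := by rw [← Real.exp_add]; simp
  have e3 : c ^ (1-β) * c ^ (β-1) = 1 := by rw [← Real.rpow_add hc]; simp
  calc x ^ j ≤ (x+1)^j := by gcongr; linarith
    _ = Real.exp c * c ^ (1-β) * (1/2)^j * (Real.exp (-c) * ((2*(x+1))^j * c ^ (β - 1))) := by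
      rw [mul_pow]
      have : (1/2:ℝ)^j * 2^j = 1 := by rw [← mul_pow]; norm_num
      calc (x+1)^j = (Real.exp c * Real.exp (-c)) * (c ^ (1-β) * c ^ (β-1)) * ((1/2:ℝ)^j * 2^j) * (x+1)^j := by
            rw [e2, e3, this]; ring
        _ = _ := by ring
    _ ≤ _ := by gcongr

lemma ml_term_norm {α β : ℝ} (hα : 0 < α) (hβ : 0 < β) (z : ℝ) (j : ℕ) :
    ‖z ^ j / Real.Gamma (α * j + β)‖ = |z| ^ j / Real.Gamma (α * j + β) := by
  have : 0 < Real.Gamma (α * j + β) := Real.Gamma_pos_of_pos (by positivity)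
  rw [norm_div, norm_pow, Real.norm_eq_abs, Real.norm_of_nonneg this.le]

lemma ml_summable' {α β : ℝ} (hα : 0 < α) (hβ : 0 < β) (z : ℝ) :
    Summable (fun j : ℕ => z ^ j / Real.Gamma (α * j + β)) := by
  apply Summable.of_norm
  simp_rw [ml_term_norm hα hβ]
  exact ml_summable hα hβ (abs_nonneg z)

lemma ml_continuous {α β : ℝ} (hα : 0 < α) (hβ : 0 < β) : Continuous (mlE α β) := by
  rw [continuous_iff_continuousAt]
  intro z
  have h : ContinuousOn (mlE α β) (Metric.ball 0 (|z|+1)) := by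
    apply continuousOn_tsum (u := fun j : ℕ => (|z|+1)^j / Real.Gamma (α * j + β))
    · intro i; fun_prop
    · exact ml_summable hα hβ (by positivity)
    · intro n x hx
      rw [ml_term_norm hα hβ]
      have : 0 < Real.Gamma (α * n + β) := Real.Gamma_pos_of_pos (by positivity)
      rw [mem_ball_zero_iff, Real.norm_eq_abs] at hx
      gcongr
  apply h.continuousAt
  apply Metric.isOpen_ball.mem_nhds
  simp

lemma ml_rec {α β : ℝ} (hα : 0 < α) (hβ : 0 < β) (z : ℝ) :
    mlE α β z = 1 / Real.Gamma β + z * mlE α (β + α) z := by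
  unfold mlE
  rw [(ml_summable' hα hβ z).tsum_eq_zero_add, ← tsum_mul_left]
  congr 1
  · simp
  · apply tsum_congr
    intro j
    rw [show α * ((j+1:ℕ):ℝ) + β = α * j + (β + α) by push_cast; ring]
    ring

lemma ml_zero {α β : ℝ} (hα : 0 < α) (hβ : 0 < β) : mlE α β 0 = 1 / Real.Gamma β := by
  rw [ml_rec hα hβ]; simp

lemma ml_beta_int {a b t : ℝ} (ha : 0 < a) (hb : 0 < b) (ht : 0 < t) :
    IntervalIntegrable (fun s : ℝ => s ^ (a-1) * (t - s) ^ (b-1)) volume 0 t := by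
  have hL : ∀ a b : ℝ, 0 < a → 
      IntervalIntegrable (fun s : ℝ => s ^ (a-1) * (t - s) ^ (b-1)) volume 0 (t/2) := by
    intro a b ha
    apply IntervalIntegrable.mul_continuousOn
    · exact intervalIntegral.intervalIntegrable_rpow' (by linarith)
    · apply ContinuousOn.rpow_const (by fun_prop)
      intro x hx
      rw [uIcc_of_le (by positivity)] at hx
      left
      have := hx.2
      have : 0 < t - x := by linarith
      exact this.ne'
  refine (hL a b ha).trans ?_
  have h := ((hL b a hb).comp_sub_left t).symm
  convert h using 1
  · ext s; rw [mul_comm, sub_sub_cancel]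
  · ring
  · ring

lemma ml_beta_val {a b t : ℝ} (ha : 0 < a) (hb : 0 < b) (ht : 0 < t) :
    ∫ s in (0:ℝ)..t, s ^ (a-1) * (t - s) ^ (b-1) =
      t ^ (a + b - 1) * (Real.Gamma a * Real.Gamma b / Real.Gamma (a+b)) := by
  have h := Complex.betaIntegral_scaled (a : ℂ) (b : ℂ) ht
  rw [Complex.betaIntegral_eq_Gamma_mul_div _ _ (by simpa) (by simpa)] at h
  have e : ∫ x in (0:ℝ)..t, (x : ℂ) ^ ((a:ℂ) - 1) * ((t : ℂ) - x) ^ ((b:ℂ) - 1) =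
      ∫ x in (0:ℝ)..t, ((x ^ (a-1) * (t - x) ^ (b-1) : ℝ) : ℂ) := by
    apply intervalIntegral.integral_congr
    intro x hx
    rw [uIcc_of_le ht.le] at hx
    simp only []
    rw [Complex.ofReal_mul, Complex.ofReal_cpow hx.1, Complex.ofReal_cpow (by linarith [hx.2])]
    push_cast
    rfl
  rw [e, intervalIntegral.integral_ofReal, ← Complex.ofReal_add, Complex.Gamma_ofReal,
    Complex.Gamma_ofReal, Complex.Gamma_ofReal] at h
  rw [show ((a+b:ℝ):ℂ) - 1 = ((a+b-1:ℝ):ℂ) by push_cast; ring, ← Complex.ofReal_cpow ht.le] at h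
  exact_mod_cast h

/-- continuity of `s ↦ E(-s^α)` -/
lemma ml_cont_comp {α β : ℝ} (hα : 0 < α) (hβ : 0 < β) :
    Continuous (fun s : ℝ => mlE α β (-s ^ α)) := by
  apply (ml_continuous hα hβ).comp
  exact (Real.continuous_rpow_const hα.le).neg

lemma ml_int {α β γ t : ℝ} (hα : 0 < α) (hβ : 0 < β) (hγ : 0 < γ) (ht : 0 < t) :
    IntervalIntegrable (fun s : ℝ => s ^ (β-1) * (t - s) ^ (γ-1) * mlE α β (-s ^ α)) volume 0 t :=
  (ml_beta_int hβ hγ ht).mul_continuousOn (ml_cont_comp hα hβ).continuousOn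

lemma ml_val {α β γ t : ℝ} (hα : 0 < α) (hβ : 0 < β) (hγ : 0 < γ) (ht : 0 < t) :
    ∫ s in (0:ℝ)..t, s ^ (β-1) * (t - s) ^ (γ-1) * mlE α β (-s ^ α) =
      Real.Gamma γ * t ^ (β + γ - 1) * mlE α (β + γ) (-t ^ α) := by
  have key : ∀ j : ℕ, ∀ s ∈ Ioc 0 t, s ^ (β-1) * (t - s) ^ (γ-1) * ((-s ^ α) ^ j / Real.Gamma (α * j + β))
      = (-1)^j / Real.Gamma (α * j + β) * (s ^ ((α * j + β)-1) * (t - s) ^ (γ-1)) := by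
    intro j s hs
    rw [show α * j + β - 1 = α * j + (β - 1) by ring, Real.rpow_add hs.1, Real.rpow_mul hs.1.le,
      Real.rpow_natCast, neg_pow]
    ring
  have hpos : ∀ j : ℕ, 0 < α * j + β := fun j => by positivity
  have tpow : ∀ j : ℕ, t ^ (α * j + β + γ - 1) = (t^α)^j * t ^ (β + γ - 1) := by
    intro j
    rw [show α * j + β + γ - 1 = α * j + (β + γ - 1) by ring, Real.rpow_add ht, Real.rpow_mul ht.le,
      Real.rpow_natCast]
  have hI : ∀ j : ℕ, IntegrableOn (fun s => (-1)^j / Real.Gamma (α * j + β) * (s ^ ((α * j + β)-1) * (t - s) ^ (γ-1))) (Ioc 0 t) := by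
    intro j
    have := (ml_beta_int (hpos j) hγ ht).const_mul ((-1)^j / Real.Gamma (α * j + β))
    rwa [intervalIntegrable_iff_integrableOn_Ioc_of_le ht.le] at this
  have hS : Summable (fun j : ℕ => ∫ s in Ioc 0 t, ‖(-1)^j / Real.Gamma (α * j + β) * (s ^ ((α * j + β)-1) * (t - s) ^ (γ-1))‖) := by
    have h0 := ((ml_summable hα (add_pos hβ hγ) (x := t^α) (by positivity)).mul_left
      (Real.Gamma γ * t ^ (β + γ - 1)))
    refine h0.congr ?_
    intro j
    have hG := Real.Gamma_pos_of_pos (hpos j)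
    have : ∫ s in Ioc 0 t, ‖(-1)^j / Real.Gamma (α * j + β) * (s ^ ((α * j + β)-1) * (t - s) ^ (γ-1))‖
      = ∫ s in Ioc 0 t, 1 / Real.Gamma (α * j + β) * (s ^ ((α * j + β)-1) * (t - s) ^ (γ-1)) := by
      apply setIntegral_congr_fun measurableSet_Ioc
      intro s hs
      have h1 : 0 < s := hs.1
      have h2 : 0 ≤ t - s := by linarith [hs.2]
      have h3 : 0 ≤ s ^ ((α * j + β)-1) * (t - s) ^ (γ-1) := by positivity
      simp only []
      rw [norm_mul, norm_div, norm_pow, norm_neg, norm_one, one_pow, Real.norm_of_nonneg hG.le,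
        Real.norm_of_nonneg h3]
    rw [this, integral_const_mul, ← intervalIntegral.integral_of_le ht.le, ml_beta_val (hpos j) hγ ht,
      tpow, ← add_assoc]
    field_simp
  have H := hasSum_integral_of_summable_integral_norm hI hS
  rw [intervalIntegral.integral_of_le ht.le]
  have e : ∫ s in Ioc 0 t, s ^ (β-1) * (t - s) ^ (γ-1) * mlE α β (-s ^ α) = 
     ∫ s in Ioc 0 t, ∑' j : ℕ, (-1)^j / Real.Gamma (α * j + β) * (s ^ ((α * j + β)-1) * (t - s) ^ (γ-1)) := by
    apply setIntegral_congr_fun measurableSet_Ioc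
    intro s hs
    simp only [mlE]
    rw [← tsum_mul_left]
    exact tsum_congr fun j => key j s hs
  rw [e, ← H.tsum_eq, mlE, ← tsum_mul_left]
  apply tsum_congr
  intro j
  have hG := Real.Gamma_pos_of_pos (hpos j)
  rw [integral_const_mul, ← intervalIntegral.integral_of_le ht.le, ml_beta_val (hpos j) hγ ht,
      tpow, ← add_assoc, neg_pow (t^α)]
  field_simp

lemma ml_pos {α : ℝ} (h0 : 0 < α) (h1 : α < 1) {t : ℝ} (ht : 0 ≤ t) :
    0 < mlE α α (-t ^ α) := by
  by_contra hneg
  push Not at hneg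
  set H : ℝ → ℝ := fun s => mlE α α (-s ^ α) with hH
  have hHc : Continuous H := ml_cont_comp h0 h0
  set G := Real.Gamma α with hGdef
  have hG : 0 < G := Real.Gamma_pos_of_pos h0
  have hH0 : 0 < H 0 := by
    simp only [hH]
    rw [Real.zero_rpow h0.ne', neg_zero, ml_zero h0 h0]
    positivity
  -- first non-positive point
  set S : Set ℝ := {s | 0 ≤ s ∧ H s ≤ 0} with hS
  have hSc : IsClosed S := by
    apply IsClosed.inter
    · exact isClosed_Ici
    · exact isClosed_le hHc continuous_const
  have hSne : S.Nonempty := ⟨t, ht, hneg⟩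
  have hSb : BddBelow S := ⟨0, fun s hs => hs.1⟩
  set T := sInf S with hT
  have hTS : T ∈ S := hSc.csInf_mem hSne hSb
  have hTpos : 0 < T := by
    rcases hTS.1.lt_or_eq with h | h
    · exact h
    · have := hTS.2
      rw [← h] at this
      linarith
  have hbelow : ∀ s, 0 ≤ s → s < T → 0 < H s := by
    intro s hs hsT
    by_contra hc
    push Not at hc
    have := csInf_le hSb (show s ∈ S from ⟨hs, hc⟩)
    linarith
  -- integral equation
  have hJ : ∀ u, 0 < u → ∫ s in (0:ℝ)..u, s ^ (α-1) * (u - s) ^ (α-1) * H s =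
      u ^ (α-1) * (1 - G * H u) := by
    intro u hu
    have e := ml_val h0 h0 h0 hu
    have r := ml_rec h0 h0 (-u ^ α)
    simp only [hH]
    rw [e, r]
    rw [show α + α - 1 = (α - 1) + α by ring, Real.rpow_add hu]
    rw [← hGdef]
    field_simp
    ring
  -- choose δ
  set c := (T/2) ^ (α-1) / α with hc
  have hcpos : 0 < c := by positivity
  have hTp : 0 < T ^ (α-1) * G := by positivity
  obtain ⟨δ, hδ0, hδT, hδ⟩ : ∃ δ : ℝ, 0 < δ ∧ δ ≤ T/2 ∧ c * δ ^ α < T ^ (α-1) * G := by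
    have hcont : Continuous (fun δ : ℝ => c * δ ^ α) :=
      continuous_const.mul (Real.continuous_rpow_const h0.le)
    have hev : ∀ᶠ δ in 𝓝 (0:ℝ), c * δ ^ α < T ^ (α-1) * G := by
      apply hcont.continuousAt.eventually_lt continuousAt_const
      rw [Real.zero_rpow h0.ne']
      simpa using hTp
    have hev2 : ∀ᶠ δ in 𝓝[>] (0:ℝ), c * δ ^ α < T ^ (α-1) * G := hev.filter_mono nhdsWithin_le_nhds
    have hev3 : ∀ᶠ δ in 𝓝[>] (0:ℝ), δ ∈ Ioc 0 (T/2) := Ioc_mem_nhdsGT (by positivity)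
    obtain ⟨δ, ha, hb⟩ := (hev2.and hev3).exists
    exact ⟨δ, hb.1, hb.2, ha⟩
  obtain ⟨p, hp, hmax⟩ := isCompact_Icc.exists_isMaxOn (s := Icc (T-δ) T)
    ⟨T, by constructor <;> linarith⟩ hHc.continuousOn
  have hHp : 0 < H p := by
    have h2 : 0 < H (T-δ) := hbelow _ (by linarith) (by linarith)
    have h3 : H (T-δ) ≤ H p := hmax (show T-δ ∈ Icc (T-δ) T by constructor <;> linarith)
    linarith
  have hpT : p < T := by
    rcases hp.2.lt_or_eq with h | h
    · exact h
    · have := hTS.2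
      rw [← h] at this
      linarith
  have hp0 : 0 < p := by linarith [hp.1]
  have hintT := ml_int h0 h0 h0 hTpos
  have hintp := ml_int h0 h0 h0 hp0
  change IntervalIntegrable (fun s : ℝ => s ^ (α-1) * (T - s) ^ (α-1) * H s) volume 0 T at hintT
  change IntervalIntegrable (fun s : ℝ => s ^ (α-1) * (p - s) ^ (α-1) * H s) volume 0 p at hintp
  have hi1 : IntervalIntegrable (fun s : ℝ => s ^ (α-1) * (T - s) ^ (α-1) * H s) volume 0 p :=
    hintT.mono_set (by rw [uIcc_of_le hp0.le, uIcc_of_le hTpos.le]; exact Icc_subset_Icc_right hpT.le)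
  have hi2 : IntervalIntegrable (fun s : ℝ => s ^ (α-1) * (T - s) ^ (α-1) * H s) volume p T :=
    hintT.mono_set (by rw [uIcc_of_le hpT.le, uIcc_of_le hTpos.le]; exact Icc_subset_Icc_left hp0.le)
  have hsplit := intervalIntegral.integral_add_adjacent_intervals hi1 hi2
  rw [hJ T hTpos] at hsplit
  have hA : ∫ s in (0:ℝ)..p, s ^ (α-1) * (T - s) ^ (α-1) * H s ≤
      (T/p) ^ (α-1) * (p ^ (α-1) * (1 - G * H p)) := by
    rw [← hJ p hp0, ← intervalIntegral.integral_const_mul]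
    apply intervalIntegral.integral_mono_on_of_le_Ioo hp0.le hi1 (hintp.const_mul _)
    intro s hs
    have hs0 : 0 < s := hs.1
    have hsp : 0 < p - s := by linarith [hs.2]
    have hHs : 0 < H s := hbelow s hs0.le (by linarith)
    have hk : (T - s) ^ (α-1) ≤ (T/p) ^ (α-1) * (p - s) ^ (α-1) := by
      rw [← Real.mul_rpow (by positivity) hsp.le]
      apply Real.rpow_le_rpow_of_nonpos (by positivity) _ (by linarith)
      rw [div_mul_eq_mul_div, div_le_iff₀ hp0]
      nlinarith
    calc s ^ (α-1) * (T - s) ^ (α-1) * H s ≤ s ^ (α-1) * ((T/p) ^ (α-1) * (p - s) ^ (α-1)) * H s := by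
          gcongr
      _ = _ := by ring
  have hA' : (T/p) ^ (α-1) * (p ^ (α-1) * (1 - G * H p)) = T ^ (α-1) * (1 - G * H p) := by
    rw [← mul_assoc, ← Real.mul_rpow (by positivity) hp0.le, div_mul_cancel₀ _ hp0.ne']
  have hi3 : IntervalIntegrable (fun s : ℝ => (T - s) ^ (α-1)) volume p T := by
    have := (intervalIntegral.intervalIntegrable_rpow' (r := α-1) (a := T - p) (b := 0)
      (by linarith)).comp_sub_left T
    simpa using this
  have hv3 : ∫ s in p..T, (T - s) ^ (α-1) = (T-p)^α / α := by
    rw [intervalIntegral.integral_comp_sub_left (fun s => s ^ (α-1)) T, sub_self,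
      integral_rpow (Or.inl (by linarith))]
    simp [Real.zero_rpow h0.ne']
  have hB : ∫ s in p..T, s ^ (α-1) * (T - s) ^ (α-1) * H s ≤ ((T/2) ^ (α-1) * H p) * ((T-p)^α / α) := by
    rw [← hv3, ← intervalIntegral.integral_const_mul]
    apply intervalIntegral.integral_mono_on_of_le_Ioo hpT.le hi2 (hi3.const_mul _)
    intro s hs
    have hsp : p < s := hs.1
    have hsT : 0 < T - s := by linarith [hs.2]
    have hHs : 0 < H s := hbelow s (by linarith) (by linarith)
    have hHsp : H s ≤ H p := hmax (show s ∈ Icc (T-δ) T by constructor <;> linarith [hp.1])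
    have hk : s ^ (α-1) ≤ (T/2) ^ (α-1) := by
      apply Real.rpow_le_rpow_of_nonpos (by positivity) _ (by linarith)
      linarith [hp.1]
    calc s ^ (α-1) * (T - s) ^ (α-1) * H s ≤ (T/2) ^ (α-1) * (T - s) ^ (α-1) * H p := by
          gcongr
      _ = _ := by ring
  have hfin : ((T/2) ^ (α-1) * H p) * ((T-p)^α / α) ≤ H p * (c * δ ^ α) := by
    have : (T-p)^α ≤ δ^α := by
      apply Real.rpow_le_rpow (by linarith) (by linarith [hp.1]) h0.le
    calc ((T/2) ^ (α-1) * H p) * ((T-p)^α / α) = H p * (c * (T-p)^α) := by rw [hc]; ring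
      _ ≤ _ := by gcongr
  have hlt : H p * (c * δ ^ α) < H p * (T ^ (α-1) * G) := by gcongr
  have hTH : 0 ≤ T ^ (α-1) * (G * (- H T)) := by
    have : 0 ≤ - H T := by linarith [hTS.2]
    positivity
  rw [hA'] at hA
  nlinarith

theorem mittagLeffler_two_sided_bounds
    (α : ℝ) (hα : α ∈ Set.Ioo (0:ℝ) 1) (x : ℝ) (hx : 0 ≤ x) :
    1 / (1 + Real.Gamma (1 - α) * x) ≤ (∑' j : ℕ, (-x) ^ j / Real.Gamma (α * j + 1)) ∧
    (∑' j : ℕ, (-x) ^ j / Real.Gamma (α * j + 1)) ≤ 1 / (1 + x / Real.Gamma (1 + α)) := by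
  obtain ⟨h0, h1⟩ := hα
  change 1 / (1 + Real.Gamma (1 - α) * x) ≤ mlE α 1 (-x) ∧ mlE α 1 (-x) ≤ 1 / (1 + x / Real.Gamma (1 + α))
  rcases hx.eq_or_lt with rfl | hx
  · simp [ml_zero h0 one_pos]
  obtain ⟨t, ht, rfl⟩ : ∃ t : ℝ, 0 < t ∧ x = t ^ α := by
    refine ⟨x ^ (1/α), by positivity, ?_⟩
    rw [← Real.rpow_mul hx.le]
    field_simp
    simp
  have hg1 : 0 < Real.Gamma (1 - α) := Real.Gamma_pos_of_pos (by linarith)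
  have hg2 : 0 < Real.Gamma (1 + α) := Real.Gamma_pos_of_pos (by linarith)
  have hg3 : 0 < Real.Gamma α := Real.Gamma_pos_of_pos h0
  have hrec : ∀ u : ℝ, mlE α 1 (-u ^ α) = 1 - u ^ α * mlE α (α + 1) (-u ^ α) := by
    intro u
    rw [ml_rec h0 one_pos, Real.Gamma_one, add_comm α 1]
    ring
  -- integral of the density
  have hI : ∀ u, 0 < u → IntervalIntegrable (fun s : ℝ => s ^ (α-1) * mlE α α (-s ^ α)) volume 0 u := by
    intro u hu
    simpa using ml_int h0 h0 one_pos hu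
  have hV : ∀ u, 0 < u → ∫ s in (0:ℝ)..u, s ^ (α-1) * mlE α α (-s ^ α) = 1 - mlE α 1 (-u ^ α) := by
    intro u hu
    have := ml_val h0 h0 one_pos hu
    rw [hrec]
    simpa using this
  constructor
  · rw [div_le_iff₀ (by positivity)]
    have hv := ml_val h0 h0 (show 0 < 1 - α by linarith) ht
    have hi := ml_int h0 h0 (show 0 < 1 - α by linarith) ht
    have hle : t ^ (-α) * (1 - mlE α 1 (-t ^ α)) ≤ Real.Gamma (1-α) * mlE α 1 (-t ^ α) := by
      have e : Real.Gamma (1-α) * mlE α 1 (-t ^ α) = Real.Gamma (1-α) * t ^ (α + (1-α) - 1) * mlE α (α + (1-α)) (-t ^ α) := by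
        rw [show α + (1-α) = 1 by ring]; simp
      rw [e, ← hv, ← hV t ht, ← intervalIntegral.integral_const_mul]
      apply intervalIntegral.integral_mono_on_of_le_Ioo ht.le ((hI t ht).const_mul _) hi
      intro s hs
      have hs0 : 0 < s := hs.1
      have hst : 0 < t - s := by linarith [hs.2]
      have hp := ml_pos h0 h1 hs0.le
      have hk : t ^ (-α) ≤ (t - s) ^ (1 - α - 1) := by
        rw [show 1 - α - 1 = -α by ring]
        exact Real.rpow_le_rpow_of_nonpos hst (by linarith) (by linarith)
      calc t ^ (-α) * (s ^ (α-1) * mlE α α (-s ^ α)) ≤ (t - s) ^ (1 - α - 1) * (s ^ (α-1) * mlE α α (-s ^ α)) := by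
            gcongr
        _ = _ := by ring
    rw [Real.rpow_neg ht.le, inv_mul_le_iff₀ (by positivity)] at hle
    linarith
  · have hmono : ∀ s ∈ Ioo 0 t, mlE α 1 (-t ^ α) ≤ mlE α 1 (-s ^ α) := by
      intro s hs
      have hnn : ∫ s in (0:ℝ)..s, s ^ (α-1) * mlE α α (-s ^ α) ≤ ∫ s in (0:ℝ)..t, s ^ (α-1) * mlE α α (-s ^ α) := by
        apply intervalIntegral.integral_mono_interval le_rfl hs.1.le hs.2.le _ (hI t ht)
        filter_upwards [ae_restrict_mem measurableSet_Ioc] with y hy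
        have hy0 : 0 < y := hy.1
        have := ml_pos h0 h1 hy0.le
        simp only [Pi.zero_apply]
        positivity
      rw [hV s hs.1, hV t ht] at hnn
      linarith
    rw [le_div_iff₀ (by positivity)]
    have hv := ml_val h0 one_pos h0 ht
    have hi := ml_int h0 one_pos h0 ht
    have hb := ml_beta_int one_pos h0 ht
    have hbv := ml_beta_val one_pos h0 ht
    have hle : mlE α 1 (-t ^ α) * ∫ s in (0:ℝ)..t, s ^ ((1:ℝ)-1) * (t - s) ^ (α-1) ≤
        ∫ s in (0:ℝ)..t, s ^ ((1:ℝ)-1) * (t - s) ^ (α-1) * mlE α 1 (-s ^ α) := by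
      rw [← intervalIntegral.integral_const_mul]
      apply intervalIntegral.integral_mono_on_of_le_Ioo ht.le (hb.const_mul _) hi
      intro s hs
      have hs0 : 0 < s := hs.1
      have hst : 0 < t - s := by linarith [hs.2]
      rw [mul_comm]
      have := hmono s hs
      gcongr
    rw [hv, hbv, Real.Gamma_one, show 1 + α - 1 = α by ring, one_mul] at hle
    have hr := hrec t
    rw [add_comm α 1] at hr
    have h5 : Real.Gamma α * (mlE α 1 (-t ^ α) * (t ^ α / Real.Gamma (1 + α))) ≤
        Real.Gamma α * (t ^ α * mlE α (1+α) (-t ^ α)) := by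
      calc _ = mlE α 1 (-t ^ α) * (t ^ α * (Real.Gamma α / Real.Gamma (1 + α))) := by ring
        _ ≤ _ := hle
        _ = _ := by ring
    have h6 := le_of_mul_le_mul_left h5 hg3
    linarith
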